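/- Let X = (c₀, |‖·‖|) be Read's space. If Y ⊆ X is a closed linear subspace of finite codimension such that Y⊥ ⊆ NA(X), then Y is proximinal in X. -/

import Mathlib

/-- The space `c₀` of real sequences converging to `0`, with the supremum norm. -/
abbrev CZero := ZeroAtInftyContinuousMap ℕ ℝ

/-- The pairing `⟨x, u - e_a⟩` of `x ∈ c₀` with `u - e_a ∈ ℓ₁`, where `u` is a finitely
supported sequence of rationals and `e_a` is the `a`-th canonical unit vector. -/
noncomputable def readPairing (u : ℕ →₀ ℚ) (a : ℕ) (x : CZero) : ℝ :=
  (∑ j ∈ u.support, (u j : ℝ) * x j) - x a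

/-- `N` is *Read's norm* on `c₀`: there are a sequence `(uₙ)` of finitely supported rational
sequences listing every such sequence infinitely many times, and a strictly increasing
sequence `(aₙ)` of positive integers with `aₙ > max supp uₙ` and `aₙ ≥ ‖uₙ‖₁`, such that
`N x = ‖x‖∞ + Σₙ 2^(-aₙ²) |⟨x, uₙ - e_{aₙ}⟩|`. -/
def IsReadNorm (N : CZero → ℝ) : Prop :=
  ∃ (u : ℕ → (ℕ →₀ ℚ)) (a : ℕ → ℕ),
    (∀ v : ℕ →₀ ℚ, {n : ℕ | u n = v}.Infinite) ∧
    StrictMono a ∧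
    (∀ n, 0 < a n) ∧
    (∀ n, ∀ j ∈ (u n).support, j < a n) ∧
    (∀ n, (∑ j ∈ (u n).support, |((u n) j : ℝ)|) ≤ (a n : ℝ)) ∧
    (∀ x : CZero, N x = ‖x‖ +
      ∑' n : ℕ, (2 : ℝ) ^ (-((a n : ℤ) ^ 2)) * |readPairing (u n) (a n) x|)

/-- A continuous linear functional `f` attains its norm with respect to the (equivalent)
norm `N`: there is `x` in the `N`-closed unit ball at which `f` equals its supremum over
that ball (i.e. its `N`-dual norm). -/
def AttainsWrt {X : Type*} [SeminormedAddCommGroup X] [NormedSpace ℝ X] (N : X → ℝ)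
    (f : X →L[ℝ] ℝ) : Prop :=
  ∃ x : X, N x ≤ 1 ∧ f x = sSup ((fun z => f z) '' {z : X | N z ≤ 1})

/-- `F` is proximinal with respect to the norm `N`: every `x` has a point of `F` realizing
the `N`-distance from `x` to `F`. -/
def ProximinalWrt {X : Type*} [SeminormedAddCommGroup X] [NormedSpace ℝ X] (N : X → ℝ)
    (F : Set X) : Prop :=
  ∀ x : X, ∃ y ∈ F, N (x - y) = sInf ((fun z => N (x - z)) '' F)

noncomputable def ebasis (j : ℕ) : CZero where
  toFun := Pi.single j 1
  continuous_toFun := continuous_of_discreteTopology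
  zero_at_infty' := by
    rw [Filter.cocompact_eq_cofinite]
    refine tendsto_const_nhds.congr' ?_
    have : ∀ᶠ i in Filter.cofinite, i ≠ j := by
      simp [Filter.eventually_cofinite]
    filter_upwards [this] with i hi
    simp [hi]

lemma ebasis_apply (j i : ℕ) : ebasis j i = if i = j then 1 else 0 := by
  change (Pi.single j 1 : ℕ → ℝ) i = _
  simp [Pi.single_apply]

lemma cz_norm_le (x : CZero) (C : ℝ) (hC : 0 ≤ C) (h : ∀ i, |x i| ≤ C) : ‖x‖ ≤ C := by
  rw [← ZeroAtInftyContinuousMap.norm_toBCF_eq_norm]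
  exact (BoundedContinuousFunction.norm_le hC).2 h

lemma cz_abs_le (x : CZero) (i : ℕ) : |x i| ≤ ‖x‖ := by
  rw [← ZeroAtInftyContinuousMap.norm_toBCF_eq_norm]
  exact BoundedContinuousFunction.norm_coe_le_norm (ZeroAtInftyContinuousMap.toBCF x) i

lemma cz_sum_apply (s : Finset ℕ) (c : ℕ → ℝ) (i : ℕ) :
    (∑ j ∈ s, c j • ebasis j) i = if i ∈ s then c i else 0 := by
  induction s using Finset.induction_on with
  | empty => simp
  | insert k s hk ih =>
    rw [Finset.sum_insert hk, ZeroAtInftyContinuousMap.add_apply, ih,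
      ZeroAtInftyContinuousMap.smul_apply, ebasis_apply]
    by_cases h : i = k
    · subst h; simp [hk]
    · simp [h]

lemma cz_hasSum (x : CZero) : HasSum (fun j => x j • ebasis j) x := by
  rw [HasSum, SummationFilter.unconditional_filter, Metric.tendsto_atTop]
  intro ε hε
  have h0 := x.zero_at_infty'
  rw [Filter.cocompact_eq_cofinite, Metric.tendsto_nhds] at h0
  have h1 := h0 (ε/2) (by positivity)
  rw [Filter.eventually_cofinite] at h1
  refine ⟨h1.toFinset, fun s hs => ?_⟩
  rw [dist_eq_norm]
  refine lt_of_le_of_lt (cz_norm_le _ (ε/2) (by positivity) fun i => ?_) (half_lt_self hε)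
  rw [ZeroAtInftyContinuousMap.sub_apply, cz_sum_apply]
  by_cases hi : i ∈ s
  · simp [hi]; positivity
  · have : i ∉ h1.toFinset := fun h => hi (hs h)
    simp only [Set.Finite.mem_toFinset, Set.mem_setOf_eq, not_not] at this
    simp only [hi, if_false, zero_sub, abs_neg]
    have h2 : |x i - 0| < ε / 2 := this
    simpa using h2.le

lemma dual_summable (h : CZero →L[ℝ] ℝ) : Summable fun j => |h (ebasis j)| := by
  refine summable_of_sum_le (c := ‖h‖) (fun _ => abs_nonneg _) fun s => ?_
  have h1 : ∑ j ∈ s, |h (ebasis j)| = h (∑ j ∈ s, (SignType.sign (h (ebasis j)) : ℝ) • ebasis j) := by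
    rw [map_sum]
    refine Finset.sum_congr rfl fun j _ => ?_
    rw [map_smul, smul_eq_mul, sign_mul_self]
  rw [h1]
  refine (le_abs_self _).trans ((h.le_opNorm _).trans ?_)
  refine mul_le_of_le_one_right (norm_nonneg _) (cz_norm_le _ _ zero_le_one fun i => ?_)
  rw [cz_sum_apply]
  split_ifs
  · rcases lt_trichotomy (h (ebasis i)) 0 with h | h | h <;> simp [h]
  · simp

lemma dual_hasSum (h : CZero →L[ℝ] ℝ) (x : CZero) :
    HasSum (fun j => h (ebasis j) * x j) (h x) := by
  have := (cz_hasSum x).mapL h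
  simpa [mul_comm] using this

lemma exists_rat_approx (c : ℕ → ℝ) (hc : Summable fun j => |c j|) (ε : ℝ) (hε : 0 < ε) :
    ∃ u : ℕ →₀ ℚ, Summable (fun j => |c j - (u j : ℝ)|) ∧ ∑' j, |c j - (u j : ℝ)| ≤ ε := by
  obtain ⟨n, hn⟩ : ∃ n, ∑' k, |c (k + n)| < ε / 2 := by
    have := tendsto_sum_nat_add (fun j => |c j|)
    exact (this.eventually_lt_const (by positivity)).exists
  have hq : ∀ j, ∃ q : ℚ, |c j - q| < ε / 2 / (n + 1) := fun j =>
    exists_rat_near (c j) (by positivity)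
  choose q hq using hq
  let u : ℕ →₀ ℚ := Finsupp.onFinset (Finset.range n) (fun j => if j < n then q j else 0)
    (by intro j hj; by_contra hh; simp at hh; simp [Nat.not_lt.2 hh] at hj)
  have hu1 : ∀ j, j < n → u j = q j := fun j hj => by simp [u, hj]
  have hu2 : ∀ j, u (j + n) = 0 := fun j => by simp [u]
  have hs : Summable (fun j => |c j - (u j : ℝ)|) := by
    rw [← summable_nat_add_iff n]
    simp only [hu2, Rat.cast_zero, sub_zero]
    exact (summable_nat_add_iff n).2 hc
  refine ⟨u, hs, ?_⟩
  rw [← hs.sum_add_tsum_nat_add n]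
  simp only [hu2, Rat.cast_zero, sub_zero]
  have h1 : ∑ j ∈ Finset.range n, |c j - (u j : ℝ)| ≤ ε / 2 := by
    calc _ ≤ ∑ j ∈ Finset.range n, ε / 2 / (n + 1) := by
          refine Finset.sum_le_sum fun j hj => ?_
          rw [hu1 j (Finset.mem_range.1 hj)]; exact (hq j).le
      _ = n * (ε / 2 / (n + 1)) := by simp
      _ ≤ ε / 2 := by
          rw [← mul_div_assoc, div_le_iff₀ (by positivity)]
          nlinarith
  linarith

lemma dual_approx (h : CZero →L[ℝ] ℝ) (ε : ℝ) (hε : 0 < ε) :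
    ∃ u : ℕ →₀ ℚ, ∀ x : CZero, |h x - ∑ j ∈ u.support, (u j : ℝ) * x j| ≤ ε * ‖x‖ := by
  obtain ⟨u, hs, hu⟩ := exists_rat_approx _ (dual_summable h) ε hε
  refine ⟨u, fun x => ?_⟩
  have h1 : HasSum (fun j => (u j : ℝ) * x j) (∑ j ∈ u.support, (u j : ℝ) * x j) :=
    hasSum_sum_of_ne_finset_zero (by intro j hj; simp at hj; simp [hj])
  have h2 := (dual_hasSum h x).sub h1
  have h3 : ∀ j, ‖h (ebasis j) * x j - (u j : ℝ) * x j‖ ≤ |h (ebasis j) - (u j : ℝ)| * ‖x‖ := by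
    intro j
    rw [← sub_mul, norm_mul, Real.norm_eq_abs, Real.norm_eq_abs]
    exact mul_le_mul_of_nonneg_left (cz_abs_le x j) (abs_nonneg _)
  have h4 := tsum_of_norm_bounded (hs.hasSum.mul_right ‖x‖) h3
  rw [h2.tsum_eq, Real.norm_eq_abs] at h4
  exact h4.trans (mul_le_mul_of_nonneg_right hu (norm_nonneg _))

lemma readPairing_add (u : ℕ →₀ ℚ) (a : ℕ) (x y : CZero) :
    readPairing u a (x + y) = readPairing u a x + readPairing u a y := by
  simp [readPairing, mul_add, Finset.sum_add_distrib]; ring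

lemma readPairing_smul (u : ℕ →₀ ℚ) (a : ℕ) (c : ℝ) (x : CZero) :
    readPairing u a (c • x) = c * readPairing u a x := by
  simp [readPairing, mul_sub, Finset.mul_sum]
  exact Finset.sum_congr rfl fun _ _ => by ring

lemma readPairing_abs (u : ℕ →₀ ℚ) (a : ℕ) (hu : (∑ j ∈ u.support, |(u j : ℝ)|) ≤ a) (x : CZero) :
    |readPairing u a x| ≤ ((a : ℝ) + 1) * ‖x‖ := by
  have h1 : |∑ j ∈ u.support, (u j : ℝ) * x j| ≤ a * ‖x‖ := by
    refine (Finset.abs_sum_le_sum_abs _ _).trans ?_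
    refine le_trans ?_ (mul_le_mul_of_nonneg_right hu (norm_nonneg x))
    rw [Finset.sum_mul]
    refine Finset.sum_le_sum fun j _ => ?_
    rw [abs_mul]
    exact mul_le_mul_of_nonneg_left (cz_abs_le x j) (abs_nonneg _)
  unfold readPairing
  have := abs_sub (∑ j ∈ u.support, (u j : ℝ) * x j) (x a)
  have := cz_abs_le x a
  linarith

lemma weight_bound (a n : ℕ) (ha : 0 < a) (hn : n ≤ a) :
    (2 : ℝ) ^ (-((a : ℤ) ^ 2)) * ((a : ℝ) + 1) ≤ 2 * (1 / 2) ^ n := by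
  have h1 : ((a : ℝ) + 1) ≤ 2 ^ a := by
    have : a + 1 ≤ 2 ^ a := Nat.lt_two_pow_self
    exact_mod_cast this
  have h2 : (2 : ℝ) ^ (-((a : ℤ) ^ 2)) * ((a : ℝ) + 1) ≤ (2 : ℝ) ^ (-((a : ℤ) ^ 2)) * 2 ^ a :=
    mul_le_mul_of_nonneg_left h1 (by positivity)
  refine h2.trans ?_
  have h3 : (2 : ℝ) * (1 / 2) ^ n = (2 : ℝ) ^ (1 - (n : ℤ)) := by
    rw [zpow_sub₀ (by norm_num)]; simp [div_eq_mul_inv]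
  rw [h3, ← zpow_natCast (2 : ℝ) a, ← zpow_add₀ (by norm_num)]
  refine zpow_le_zpow_right₀ (by norm_num) ?_
  have : (1 : ℤ) ≤ a := by exact_mod_cast ha
  have : (n : ℤ) ≤ a := by exact_mod_cast hn
  nlinarith

structure RN (N : CZero → ℝ) : Prop where
  add : ∀ x y, N (x + y) ≤ N x + N y
  hom : ∀ (c : ℝ) x, 0 ≤ c → N (c • x) = c * N x
  lower : ∀ x, ‖x‖ ≤ N x
  upper : ∃ C : ℝ, 0 ≤ C ∧ ∀ x, N x ≤ C * ‖x‖
  key : ∀ (h : CZero →L[ℝ] ℝ) (R δ : ℝ), 0 < R → 0 < δ → ∃ η : ℝ, 0 < η ∧ ∀ x y : CZero,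
    ‖x‖ ≤ R → ‖y‖ ≤ R → δ ≤ h x → h y ≤ -δ → N (x + y) + η ≤ N x + N y

lemma IsReadNorm.rn {N : CZero → ℝ} (hN : IsReadNorm N) : RN N := by
  obtain ⟨u, a, hu, ha, hpos, -, hul, hNx⟩ := hN
  have hb : ∀ x n, (2 : ℝ) ^ (-((a n : ℤ) ^ 2)) * |readPairing (u n) (a n) x| ≤
      2 * (1 / 2) ^ n * ‖x‖ := by
    intro x n
    calc _ ≤ (2 : ℝ) ^ (-((a n : ℤ) ^ 2)) * (((a n : ℝ) + 1) * ‖x‖) :=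
          mul_le_mul_of_nonneg_left (readPairing_abs _ _ (hul n) x) (by positivity)
      _ = (2 : ℝ) ^ (-((a n : ℤ) ^ 2)) * ((a n : ℝ) + 1) * ‖x‖ := by ring
      _ ≤ _ := mul_le_mul_of_nonneg_right (weight_bound _ _ (hpos n) ha.le_apply) (norm_nonneg _)
  have hgeo : ∀ x : CZero, HasSum (fun n : ℕ => 2 * (1 / 2 : ℝ) ^ n * ‖x‖) (2 * 2 * ‖x‖) :=
    fun x => (hasSum_geometric_two.mul_left 2).mul_right _
  have hsum : ∀ x, Summable fun n : ℕ =>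
      (2 : ℝ) ^ (-((a n : ℤ) ^ 2)) * |readPairing (u n) (a n) x| := fun x =>
    Summable.of_nonneg_of_le (fun n => by positivity) (hb x) (hgeo x).summable
  have hle : ∀ x y n, (2 : ℝ) ^ (-((a n : ℤ) ^ 2)) * |readPairing (u n) (a n) (x + y)| ≤
      (2 : ℝ) ^ (-((a n : ℤ) ^ 2)) * |readPairing (u n) (a n) x| +
      (2 : ℝ) ^ (-((a n : ℤ) ^ 2)) * |readPairing (u n) (a n) y| := by
    intro x y n
    rw [readPairing_add, ← mul_add]
    exact mul_le_mul_of_nonneg_left (abs_add_le _ _) (by positivity)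
  refine ⟨?_, ?_, ?_, ⟨1 + 2 * 2, by norm_num, ?_⟩, ?_⟩
  · intro x y
    rw [hNx, hNx, hNx]
    have h1 := Summable.tsum_le_tsum (hle x y) (hsum _) ((hsum x).add (hsum y))
    rw [Summable.tsum_add (hsum x) (hsum y)] at h1
    linarith [norm_add_le x y]
  · intro c x hc
    rw [hNx, hNx, norm_smul, Real.norm_of_nonneg hc, mul_add, ← tsum_mul_left]
    congr 2
    ext n
    rw [readPairing_smul, abs_mul, abs_of_nonneg hc]; ring
  · intro x
    rw [hNx]
    have := tsum_nonneg (L := .unconditional ℕ) (g := fun n : ℕ =>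
      (2 : ℝ) ^ (-((a n : ℤ) ^ 2)) * |readPairing (u n) (a n) x|) fun n => by positivity
    linarith
  · intro x
    rw [hNx]
    have := Summable.tsum_le_tsum (hb x) (hsum x) (hgeo x).summable
    rw [(hgeo x).tsum_eq] at this
    linarith
  · intro h R δ hR hδ
    obtain ⟨v, hv⟩ := dual_approx h (δ / 2 / R) (by positivity)
    obtain ⟨K, hK⟩ := exists_nat_gt ((R + 1) / (δ / 2))
    rw [div_lt_iff₀ (by positivity)] at hK
    obtain ⟨n, hn⟩ := (hu ((K : ℚ) • v)).nonempty
    simp only [Set.mem_setOf_eq] at hn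
    have hK0 : (K : ℚ) ≠ 0 := by
      rintro h0
      have : (K : ℝ) = 0 := by exact_mod_cast h0
      rw [this] at hK; linarith
    have hpair : ∀ x, readPairing (u n) (a n) x =
        K * (∑ j ∈ v.support, (v j : ℝ) * x j) - x (a n) := by
      intro x
      rw [readPairing, hn, Finsupp.support_smul_eq hK0, Finset.mul_sum]
      congr 1
      refine Finset.sum_congr rfl fun j _ => ?_
      simp [mul_assoc]
    have happ : ∀ x : CZero, ‖x‖ ≤ R → |h x - ∑ j ∈ v.support, (v j : ℝ) * x j| ≤ δ / 2 := by
      intro x hx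
      refine (hv x).trans ?_
      calc δ / 2 / R * ‖x‖ ≤ δ / 2 / R * R := mul_le_mul_of_nonneg_left hx (by positivity)
        _ = δ / 2 := by field_simp
    refine ⟨(2 : ℝ) ^ (-((a n : ℤ) ^ 2)), by positivity, fun x y hx hy hhx hhy => ?_⟩
    have px : 1 ≤ readPairing (u n) (a n) x := by
      rw [hpair]
      have h1 := abs_le.1 (happ x hx)
      have h2 := abs_le.1 (cz_abs_le x (a n))
      have h3 : (K : ℝ) * (δ / 2) ≤ K * (∑ j ∈ v.support, (v j : ℝ) * x j) :=
        mul_le_mul_of_nonneg_left (by linarith) (by positivity)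
      linarith
    have py : readPairing (u n) (a n) y ≤ -1 := by
      rw [hpair]
      have h1 := abs_le.1 (happ y hy)
      have h2 := abs_le.1 (cz_abs_le y (a n))
      have h3 : (K : ℝ) * (∑ j ∈ v.support, (v j : ℝ) * y j) ≤ K * (-(δ / 2)) :=
        mul_le_mul_of_nonneg_left (by linarith) (by positivity)
      linarith
    have hp : |readPairing (u n) (a n) (x + y)| + 1 ≤
        |readPairing (u n) (a n) x| + |readPairing (u n) (a n) y| := by
      rw [readPairing_add, abs_of_nonneg (by linarith : 0 ≤ readPairing (u n) (a n) x),
        abs_of_nonpos (by linarith : readPairing (u n) (a n) y ≤ 0), ← le_sub_iff_add_le, abs_le]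
      constructor <;> linarith
    have hq := mul_le_mul_of_nonneg_left hp
      (by positivity : (0 : ℝ) ≤ (2 : ℝ) ^ (-((a n : ℤ) ^ 2)))
    rw [hNx, hNx, hNx]
    have hd := ((hsum x).add (hsum y)).sub (hsum (x + y))
    have h1 := hd.le_tsum n (fun m _ => sub_nonneg.2 (hle x y m))
    rw [Summable.tsum_sub ((hsum x).add (hsum y)) (hsum _),
      Summable.tsum_add (hsum x) (hsum y)] at h1
    linarith [norm_add_le x y]

lemma RN.main {N : CZero → ℝ} (hN : RN N)
    (Y : Submodule ℝ CZero) (hYc : IsClosed (Y : Set CZero))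
    (hNA : ∀ f : CZero →L[ℝ] ℝ, (∀ y ∈ Y, f y = 0) → AttainsWrt N f) :
    ProximinalWrt N (Y : Set CZero) := by
  intro x0
  have hnn : ∀ x, 0 ≤ N x := fun x => (norm_nonneg x).trans (hN.lower x)
  have hN0 : N 0 = 0 := by simpa using hN.hom 0 0 le_rfl
  obtain ⟨C, hC, hup⟩ := hN.upper
  set D := (fun z => N (x0 - z)) '' (Y : Set CZero) with hD
  have hbdd : BddBelow D := ⟨0, by rintro _ ⟨z, _, rfl⟩; exact hnn _⟩
  have hne : D.Nonempty := ⟨_, 0, Y.zero_mem, rfl⟩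
  set d := sInf D with hd
  have hdle : ∀ y ∈ Y, d ≤ N (x0 - y) := fun y hy => csInf_le hbdd ⟨y, hy, rfl⟩
  have hdex : ∀ η > 0, ∃ y ∈ Y, N (x0 - y) < d + η := by
    intro η hη
    obtain ⟨_, ⟨y, hy, rfl⟩, h⟩ := exists_lt_of_csInf_lt hne (show sInf D < d + η by linarith)
    exact ⟨y, hy, h⟩
  have hd0 : 0 ≤ d := le_csInf hne (by rintro _ ⟨z, _, rfl⟩; exact hnn _)
  rcases hd0.eq_or_lt with hd0 | hd0
  · have : x0 ∈ (Y : Set CZero) := by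
      rw [← hYc.closure_eq, Metric.mem_closure_iff]
      intro ε hε
      obtain ⟨y, hy, h⟩ := hdex ε hε
      refine ⟨y, hy, ?_⟩
      rw [dist_eq_norm]
      linarith [hN.lower (x0 - y)]
    exact ⟨x0, this, by rw [sub_self, hN0, hd0]⟩
  have hcont : Continuous N := by
    refine (LipschitzWith.of_le_add_mul ⟨C, hC⟩ fun x y => ?_).continuous
    have h1 := hN.add y (x - y)
    rw [add_sub_cancel] at h1
    have h2 := hup (x - y)
    rw [dist_eq_norm]
    exact h1.trans (add_le_add_right h2 _)
  have hconv : Convex ℝ {x | N x < d} := by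
    intro x hx y hy s t hs ht hst
    simp only [Set.mem_setOf_eq] at *
    have h1 := hN.add (s • x) (t • y)
    rw [hN.hom s x hs, hN.hom t y ht] at h1
    rcases hs.eq_or_lt with rfl | hs
    · obtain rfl : t = 1 := by linarith
      linarith
    · nlinarith
  have hconvA : Convex ℝ {x | x0 - x ∈ Y} := by
    intro x hx y hy s t hs ht hst
    simp only [Set.mem_setOf_eq] at *
    have : x0 - (s • x + t • y) = s • (x0 - x) + t • (x0 - y) := by
      obtain rfl : t = 1 - s := by linarith
      ext i
      simp
      ring
    rw [this]
    exact Y.add_mem (Y.smul_mem _ hx) (Y.smul_mem _ hy)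
  have hdisj : Disjoint {x | N x < d} {x | x0 - x ∈ Y} := by
    rw [Set.disjoint_left]
    intro x hx hx'
    have := hdle _ hx'
    rw [sub_sub_cancel] at this
    exact absurd hx (not_lt.2 this)
  obtain ⟨f, r, hf1, hf2⟩ := geometric_hahn_banach_open hconv
    (isOpen_lt hcont continuous_const) hconvA hdisj
  have hr : 0 < r := by simpa using hf1 0 (by simpa [hN0] using hd0)
  have hfY : ∀ y ∈ Y, f y = 0 := by
    intro y hy
    by_contra hne
    have := hf2 (x0 - ((f x0 - r + 1) / f y) • y) (by
      simp only [Set.mem_setOf_eq, sub_sub_cancel]; exact Y.smul_mem _ hy)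
    rw [map_sub, map_smul, smul_eq_mul, div_mul_cancel₀ _ hne] at this
    linarith
  set c := f x0 with hc
  have hrc : r ≤ c := hf2 x0 (by simp)
  have hfle : ∀ x, d * f x ≤ c * N x := by
    intro x
    by_contra! hcon
    have hfx : 0 < d * f x := lt_of_le_of_lt (mul_nonneg (by linarith) (hnn x)) hcon
    have hfx : 0 < f x := pos_of_mul_pos_right hfx hd0.le
    have h1 := hf1 ((c / f x) • x) (by
      simp only [Set.mem_setOf_eq]
      rw [hN.hom _ _ (div_nonneg (by linarith) hfx.le), div_mul_eq_mul_div, div_lt_iff₀ hfx]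
      exact hcon)
    rw [map_smul, smul_eq_mul, div_mul_cancel₀ _ hfx.ne'] at h1
    linarith
  obtain ⟨w, hw1, hw2⟩ := hNA f hfY
  have hbd : BddAbove ((fun z => f z) '' {z | N z ≤ 1}) := by
    refine ⟨c / d, ?_⟩
    rintro _ ⟨z, hz, rfl⟩
    simp only [Set.mem_setOf_eq] at hz
    rw [le_div_iff₀ hd0]
    nlinarith [hfle z]
  have hsup : ∀ z, N z ≤ 1 → f z ≤ f w := fun z hz => by
    rw [hw2]; exact le_csSup hbd ⟨z, hz, rfl⟩
  have hcy : ∀ y ∈ Y, c ≤ f w * N (x0 - y) := by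
    intro y hy
    have hp : 0 < N (x0 - y) := hd0.trans_le (hdle y hy)
    have := hsup ((N (x0 - y))⁻¹ • (x0 - y)) (by
      rw [hN.hom _ _ (by positivity), inv_mul_cancel₀ hp.ne'])
    rw [map_smul, map_sub, hfY y hy, sub_zero, smul_eq_mul, inv_mul_le_iff₀ hp] at this
    linarith
  have hc0 : 0 < c := by linarith
  have hfw0 : 0 < f w := by
    have := hcy 0 Y.zero_mem
    by_contra! h
    nlinarith [hnn (x0 - 0)]
  have hfw : d * f w = c := by
    apply le_antisymm
    · nlinarith [hfle w]
    · have : c / f w ≤ d := le_csInf hne (by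
        rintro _ ⟨y, hy, rfl⟩
        rw [div_le_iff₀ hfw0]
        linarith [hcy y hy])
      rwa [div_le_iff₀ hfw0] at this
  -- sign lemma
  have hNdw : N (d • w) ≤ d := by
    rw [hN.hom _ _ hd0.le]; nlinarith
  have hsign : ∀ h : CZero →L[ℝ] ℝ, (∀ y ∈ Y, h y = 0) → ∀ δ > 0, δ ≤ h x0 →
      h (d • w) ≤ -δ → False := by
    intro h hh δ hδ h1 h2
    obtain ⟨η, hη, hk⟩ := hN.key h (d + 1) δ (by linarith) hδ
    obtain ⟨y, hy, hlt⟩ := hdex (min η 1) (by positivity)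
    have hm1 := min_le_left η 1
    have hm2 := min_le_right η 1
    have := hk (x0 - y) (d • w) (by linarith [hN.lower (x0 - y)])
      (by linarith [hN.lower (d • w)]) (by rw [map_sub, hh y hy]; linarith) h2
    have h3 := hfle (x0 - y + d • w)
    rw [map_add, map_sub, hfY y hy, map_smul, smul_eq_mul, hfw, ← hc] at h3
    have h4 : 2 * d ≤ N (x0 - y + d • w) := by
      by_contra! h5
      nlinarith
    linarith
  have hle : ∀ h : CZero →L[ℝ] ℝ, (∀ y ∈ Y, h y = 0) → h x0 ≤ h (d • w) := by
    intro h hh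
    by_contra! hlt
    set m := (h x0 + h (d • w)) / 2 with hm
    refine hsign (h - (m / c) • f) (fun y hy => by simp [hh y hy, hfY y hy])
      ((h x0 - h (d • w)) / 2) (by linarith) ?_ ?_
    · have : (h - (m / c) • f) x0 = h x0 - m := by
        simp [← hc, hc0.ne']
      rw [this]; linarith
    · have : (h - (m / c) • f) (d • w) = h (d • w) - m := by
        have : f (d • w) = c := by rw [map_smul, smul_eq_mul, hfw]
        rw [ContinuousLinearMap.sub_apply, ContinuousLinearMap.smul_apply, this, smul_eq_mul,
          div_mul_cancel₀ _ hc0.ne']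
      rw [this]; linarith
  have hmem : x0 - d • w ∈ Y := by
    by_contra hnot
    obtain ⟨g, t, hg1, hg2⟩ := geometric_hahn_banach_point_closed Y.convex hYc hnot
    have hgY : ∀ y ∈ Y, g y = 0 := by
      intro y hy
      by_contra hne
      have := hg2 (((t - 1) / g y) • y) (Y.smul_mem _ hy)
      rw [map_smul, smul_eq_mul, div_mul_cancel₀ _ hne] at this
      linarith
    have h0 := hg2 0 Y.zero_mem
    have h1 := hle g hgY
    have h2 := hle (-g) (fun y hy => by simp [hgY y hy])
    simp only [ContinuousLinearMap.neg_apply] at h2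
    rw [map_sub] at hg1
    rw [map_zero] at h0
    linarith
  refine ⟨_, hmem, le_antisymm ?_ (hdle _ hmem)⟩
  rw [sub_sub_cancel]
  exact hNdw

/-- Let `X = (c₀, N)` be Read's space.  If `Y ⊆ X` is a closed linear
subspace of finite codimension such that `Y⊥ ⊆ NA(X)`, then `Y` is proximinal in `X`
(with respect to `N`). -/
theorem stmt17 (N : CZero → ℝ) (hN : IsReadNorm N)
    (Y : Submodule ℝ CZero) (hYc : IsClosed (Y : Set CZero))
    [FiniteDimensional ℝ (CZero ⧸ Y)]
    (hNA : ∀ f : CZero →L[ℝ] ℝ, (∀ y ∈ Y, f y = 0) → AttainsWrt N f) :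
    ProximinalWrt N (Y : Set CZero) := by
  exact hN.rn.main Y hYc hNA
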